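/- arXiv:2101.00344 — 4 statements merged into one kernel-verified Lean document; each statement's English description precedes it below -/
import Mathlib

section
/- Let G be a group, let a, b ∈ G, and let s and t be nonempty finite multisets of elements of G such that the multiset s + s.map (fun g => a * g) equals the multiset t + t.map (fun h => b * h). Then there exist an integer k ≥ 1 and signs ε₁, δ₁, …, ε_k, δ_k ∈ {1, −1} such that a^{ε₁} b^{δ₁} ⋯ a^{ε_k} b^{δ_k} = 1 in G. In particular, s and t have the same cardinality. -/
/-- Following `n` steps of a self-map each of which divides on the left by some `a^{±1} b^{±1}`
expresses the starting point as an alternating word of length `n` times the end point. -/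
theorem exists_alternating_word_mul_iterate {G : Type*} [Group G] (a b : G) {V : Set G}
    (f : V → V)
    (hf : ∀ v : V, ∃ e d : ℤ, (e = 1 ∨ e = -1) ∧ (d = 1 ∨ d = -1) ∧
      (v : G) = a ^ e * b ^ d * (f v : G)) (n : ℕ) (v : V) :
    ∃ ε δ : Fin n → ℤ, (∀ i, ε i = 1 ∨ ε i = -1) ∧ (∀ i, δ i = 1 ∨ δ i = -1) ∧
      (v : G) = (List.ofFn (fun i : Fin n => a ^ (ε i) * b ^ (δ i))).prod * (f^[n] v : G) := by
  induction n generalizing v with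
  | zero => exact ⟨Fin.elim0, Fin.elim0, fun i => i.elim0, fun i => i.elim0, by simp⟩
  | succ n ih =>
    obtain ⟨e, d, he, hd, hv⟩ := hf v
    obtain ⟨ε, δ, hε, hδ, hfv⟩ := ih (f v)
    refine ⟨Fin.cons e ε, Fin.cons d δ, Fin.cases he hε, Fin.cases hd hδ, ?_⟩
    rw [hv, hfv]
    simp [List.ofFn_succ, mul_assoc]

/-- A self-map of a nonempty finite type has a periodic point. -/
theorem exists_pos_iterate_eq_self {α : Type*} [Finite α] [Nonempty α] (f : α → α) :
    ∃ n : ℕ, 1 ≤ n ∧ ∃ x, f^[n] x = x := by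
  obtain ⟨x⟩ := ‹Nonempty α›
  obtain ⟨m, n, hlt, hmn⟩ :=
    Set.finite_univ.exists_lt_map_eq_of_forall_mem (f := fun n : ℕ => f^[n] x)
      fun _ => Set.mem_univ _
  refine ⟨n - m, by omega, f^[m] x, ?_⟩
  rw [← Function.iterate_add_apply, Nat.sub_add_cancel hlt.le]
  exact hmn.symm

/-- Every element of `s + c • s` stays in it after left division by `c` or by `c⁻¹`. -/
theorem exists_zpow_mul_mem_add_map {G : Type*} [Group G] (c : G) (s : Multiset G) {v : G}
    (hv : v ∈ s + s.map (fun g => c * g)) :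
    ∃ e : ℤ, (e = 1 ∨ e = -1) ∧ ∃ w ∈ s + s.map (fun g => c * g), v = c ^ e * w := by
  rcases Multiset.mem_add.1 hv with hv | hv
  · exact ⟨-1, .inr rfl, c * v,
      Multiset.mem_add.2 (.inr (Multiset.mem_map_of_mem _ hv)), by simp⟩
  · obtain ⟨w, hw, rfl⟩ := Multiset.mem_map.1 hv
    exact ⟨1, .inl rfl, w, Multiset.mem_add.2 (.inl hw), by simp⟩

/-- If `s` and `t` are nonempty multisets over a group `G` with
`s + s.map (a * ·) = t + t.map (b * ·)`, then there is an alternating relation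
`a^{ε₁} b^{δ₁} ⋯ a^{ε_k} b^{δ_k} = 1` in `G`, and `s` and `t` have the same cardinality. -/
theorem alternating_relation_of_multiset_eq {G : Type*} [Group G] (a b : G)
    (s t : Multiset G) (hs : s ≠ 0) (ht : t ≠ 0)
    (h : s + s.map (fun g => a * g) = t + t.map (fun h => b * h)) :
    (∃ k : ℕ, 1 ≤ k ∧ ∃ ε δ : Fin k → ℤ,
      (∀ i, ε i = 1 ∨ ε i = -1) ∧ (∀ i, δ i = 1 ∨ δ i = -1) ∧
      (List.ofFn (fun i : Fin k => a ^ (ε i) * b ^ (δ i))).prod = 1) ∧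
    Multiset.card s = Multiset.card t := by
  refine ⟨?_, ?_⟩
  · let V : Set G := {v | v ∈ s + s.map (fun g => a * g)}
    have : Finite V := Multiset.finite_toSet _
    have : Nonempty V := by
      obtain ⟨g, hg⟩ := Multiset.exists_mem_of_ne_zero hs
      exact ⟨g, Multiset.mem_add.2 (.inl hg)⟩
    have step : ∀ v : V, ∃ w : V, ∃ e d : ℤ, (e = 1 ∨ e = -1) ∧ (d = 1 ∨ d = -1) ∧
        (v : G) = a ^ e * b ^ d * (w : G) := by
      rintro ⟨v, hv⟩
      obtain ⟨e, he, u, hu, rfl⟩ := exists_zpow_mul_mem_add_map a s hv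
      obtain ⟨d, hd, w, hw, rfl⟩ := exists_zpow_mul_mem_add_map b t (Multiset.mem_of_le h.le hu)
      exact ⟨⟨w, Multiset.mem_of_le h.ge hw⟩, e, d, he, hd, (mul_assoc _ _ _).symm⟩
    choose f hf using step
    obtain ⟨k, hk, x, hx⟩ := exists_pos_iterate_eq_self f
    obtain ⟨ε, δ, hε, hδ, hprod⟩ := exists_alternating_word_mul_iterate a b f hf k x
    rw [hx] at hprod
    exact ⟨k, hk, ε, δ, hε, hδ, right_eq_mul.1 hprod⟩
  · have hcard := congrArg Multiset.card h
    simp only [Multiset.card_add, Multiset.card_map] at hcard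
    omega
end

section
/- Let G be the free metabelian group of rank 2, i.e., the quotient of the free group F₂ on two generators by the second term of its derived series (the derived subgroup of the derived subgroup), and let a, b ∈ G be the images of the two free generators. Then for every integer k ≥ 1 and all signs ε₁, δ₁, …, ε_k, δ_k ∈ {1, −1}, the element a^{ε₁} b^{δ₁} ⋯ a^{ε_k} b^{δ_k} is not the identity of G. -/
instance : (derivedSeries (FreeGroup (Fin 2)) 2).Normal := derivedSeries_normal _ _

/-- The second derived subgroup of a dihedral group is trivial. -/
theorem DihedralGroup.derivedSeries_two (n : ℕ) : derivedSeries (DihedralGroup n) 2 = ⊥ := by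
  have h1 : derivedSeries (DihedralGroup n) 1 ≤ Subgroup.zpowers (DihedralGroup.r 1) := by
    rw [derivedSeries_succ, Subgroup.commutator_le]
    have hr (i : ZMod n) : DihedralGroup.r i ∈ Subgroup.zpowers (DihedralGroup.r (1 : ZMod n)) := by
      obtain ⟨m, rfl⟩ := ZMod.intCast_surjective i
      exact ⟨m, DihedralGroup.r_one_zpow m⟩
    rintro (i | i) - (j | j) - <;> simp only [commutatorElement_def, DihedralGroup.inv_r,
      DihedralGroup.inv_sr, DihedralGroup.r_mul_r, DihedralGroup.r_mul_sr,
      DihedralGroup.sr_mul_r, DihedralGroup.sr_mul_sr, hr]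
  rw [derivedSeries_succ, eq_bot_iff]
  refine (Subgroup.commutator_mono h1 h1).trans (Subgroup.commutator_le.2 ?_)
  rintro _ ⟨m, rfl⟩ _ ⟨l, rfl⟩
  rw [Subgroup.mem_bot, commutatorElement_eq_one_iff_commute]
  exact (Commute.refl _).zpow_zpow m l

/-- An element equal to its own inverse equals each of its powers with exponent `1` or `-1`. -/
theorem zpow_eq_self_of_inv_eq_self {G : Type*} [Group G] {x : G} (hx : x⁻¹ = x) {e : ℤ}
    (he : e = 1 ∨ e = -1) : x ^ e = x := by
  rcases he with rfl | rfl <;> simp [hx]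

/-- In the free metabelian group of rank 2 (the free group on two generators modulo its second
derived subgroup), no alternating word `a^{ε₁} b^{δ₁} ⋯ a^{ε_k} b^{δ_k}` (with `k ≥ 1`) in the
images `a`, `b` of the free generators equals the identity. -/
theorem free_metabelian_no_alternating_relation
    (a b : FreeGroup (Fin 2) ⧸ derivedSeries (FreeGroup (Fin 2)) 2)
    (ha : a = QuotientGroup.mk (FreeGroup.of 0))
    (hb : b = QuotientGroup.mk (FreeGroup.of 1))
    (k : ℕ) (hk : 1 ≤ k) (ε δ : Fin k → ℤ)
    (hε : ∀ i, ε i = 1 ∨ ε i = -1) (hδ : ∀ i, δ i = 1 ∨ δ i = -1) :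
    (List.ofFn (fun i : Fin k => a ^ (ε i) * b ^ (δ i))).prod ≠ 1 := by
  let φ : FreeGroup (Fin 2) →* DihedralGroup 0 :=
    FreeGroup.lift ![DihedralGroup.sr 0, DihedralGroup.sr 1]
  have hφ : derivedSeries (FreeGroup (Fin 2)) 2 ≤ φ.ker := by
    rw [← MonoidHom.comap_bot, ← Subgroup.map_le_iff_le_comap,
      ← DihedralGroup.derivedSeries_two 0]
    exact map_derivedSeries_le_derivedSeries φ 2
  let ψ := QuotientGroup.lift (derivedSeries (FreeGroup (Fin 2)) 2) φ hφ
  have hψa : ψ a = DihedralGroup.sr 0 := by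
    rw [ha]
    exact (QuotientGroup.lift_mk _ hφ _).trans (FreeGroup.lift_apply_of ..)
  have hψb : ψ b = DihedralGroup.sr 1 := by
    rw [hb]
    exact (QuotientGroup.lift_mk _ hφ _).trans (FreeGroup.lift_apply_of ..)
  intro h
  have hletter (i : Fin k) : ψ (a ^ ε i * b ^ δ i) = DihedralGroup.r 1 := by
    rw [map_mul, map_zpow, map_zpow, hψa, hψb,
      zpow_eq_self_of_inv_eq_self (DihedralGroup.inv_sr 0) (hε i),
      zpow_eq_self_of_inv_eq_self (DihedralGroup.inv_sr 1) (hδ i),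
      DihedralGroup.sr_mul_sr, sub_zero]
  have hpow : (DihedralGroup.r 1 : DihedralGroup 0) ^ k = 1 := by
    have h' := congrArg ψ h
    rw [map_list_prod, List.map_ofFn, map_one] at h'
    rw [← h', funext (f := ψ ∘ _) (g := fun _ => DihedralGroup.r 1) hletter, List.ofFn_const,
      List.prod_replicate]
  have hdvd := orderOf_dvd_of_pow_eq_one hpow
  rw [DihedralGroup.orderOf_r_one, zero_dvd_iff] at hdvd
  omega
end

section
/- Let F be R. Thompson's group, presented on generators x₀, x₁, x₂, … (indexed by ℕ) with defining relations x_j x_i = x_i x_{j+1} for all 0 ≤ i < j. Then for every integer k ≥ 1, all indices i₁, …, i_k ∈ ℕ that are even, all indices j₁, …, j_k ∈ ℕ that are odd, and all signs ε₁, δ₁, …, ε_k, δ_k ∈ {1, −1}, the element x_{i₁}^{ε₁} x_{j₁}^{δ₁} ⋯ x_{i_k}^{ε_k} x_{j_k}^{δ_k} is not the identity of F. -/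
/-- The defining relators of R. Thompson's group `F`: `x_j x_i x_{j+1}⁻¹ x_i⁻¹` for `i < j`. -/
def thompsonRels : Set (FreeGroup ℕ) :=
  {r | ∃ i j : ℕ, i < j ∧
    r = FreeGroup.of j * FreeGroup.of i * (FreeGroup.of (j + 1))⁻¹ * (FreeGroup.of i)⁻¹}

/-- R. Thompson's group `F`, presented on generators `x₀, x₁, x₂, …` with relations
`x_j x_i = x_i x_{j+1}` for `i < j`. -/
abbrev ThompsonF : Type := PresentedGroup thompsonRels

/-- The generator `x_n` of Thompson's group `F`. -/
def x (n : ℕ) : ThompsonF := PresentedGroup.of n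

namespace ThompsonF

theorem x_mul_x {i j : ℕ} (h : i < j) : x j * x i = x i * x (j + 1) := by
  have h1 : (PresentedGroup.mk thompsonRels) (FreeGroup.of j * FreeGroup.of i *
      (FreeGroup.of (j + 1))⁻¹ * (FreeGroup.of i)⁻¹) = 1 :=
    PresentedGroup.one_of_mem ⟨i, j, h, rfl⟩
  simp only [map_mul, map_inv] at h1
  exact mul_inv_eq_iff_eq_mul.mp (mul_inv_eq_one.mp h1) |>.trans rfl

/-! ### The piecewise linear action on the line -/

/-- The homeomorphism of `ℝ` by which `x n` acts: the identity on `(-∞, n]`, contraction of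
`[n, n + 2]` onto `[n, n + 1]`, and translation by `-1` on `[n + 2, ∞)`. -/
noncomputable def contraction (n : ℕ) : Equiv.Perm ℝ where
  toFun t := if t ≤ n then t else if t ≤ n + 2 then (t + n) / 2 else t - 1
  invFun t := if t ≤ n then t else if t ≤ n + 1 then 2 * t - n else t + 1
  left_inv t := by dsimp only; split_ifs <;> linarith
  right_inv t := by dsimp only; split_ifs <;> linarith

theorem contraction_apply (n : ℕ) (t : ℝ) :
    contraction n t = if t ≤ n then t else if t ≤ n + 2 then (t + n) / 2 else t - 1 := rfl

theorem contraction_inv_apply (n : ℕ) (t : ℝ) :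
    (contraction n)⁻¹ t = if t ≤ n then t else if t ≤ n + 1 then 2 * t - n else t + 1 := rfl

theorem contraction_mul_contraction {i j : ℕ} (h : i < j) :
    contraction j * contraction i = contraction i * contraction (j + 1) := by
  have h' : (i : ℝ) + 1 ≤ j := by exact_mod_cast h
  ext t
  simp only [Equiv.Perm.mul_apply, contraction_apply]
  push_cast
  split_ifs <;> linarith

/-- The action of Thompson's group on the line. -/
noncomputable def action : ThompsonF →* Equiv.Perm ℝ :=
  PresentedGroup.toGroup (f := contraction) <| by
    rintro r ⟨i, j, h, rfl⟩
    simp [contraction_mul_contraction h]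

theorem action_x (n : ℕ) : action (x n) = contraction n := PresentedGroup.toGroup.of _

/-- The elements acting trivially on `(-∞, n]`. -/
noncomputable def rayFixer (n : ℕ) : Subgroup ThompsonF where
  carrier := {g | ∀ t : ℝ, t ≤ n → action g t = t}
  one_mem' t _ := by simp
  mul_mem' {g h} hg hh t ht := by
    rw [map_mul, Equiv.Perm.mul_apply, hh t ht, hg t ht]
  inv_mem' {g} hg t ht := by
    rw [map_inv, Equiv.Perm.inv_eq_iff_eq, hg t ht]

theorem rayFixer_antitone : Antitone rayFixer := fun m n h _ hg t ht =>
  hg t (ht.trans (by exact_mod_cast h))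

theorem x_mem_rayFixer {m n : ℕ} (h : m ≤ n) : x n ∈ rayFixer m := by
  refine rayFixer_antitone h fun t ht => ?_
  rw [action_x, contraction_apply, if_pos ht]

theorem mem_rayFixer_of_conj_mem {m : ℕ} {g : ThompsonF}
    (h : x m * g * (x m)⁻¹ ∈ rayFixer (m + 1)) : g ∈ rayFixer (m + 2) := by
  intro t ht
  have hle : contraction m t ≤ (m + 1 : ℕ) := by
    push_cast at ht ⊢
    rw [contraction_apply]
    split_ifs <;> linarith
  have := h _ hle
  simpa [action_x] using this

/-! ### Words -/

/-- The element represented by a word, `(n, true)` standing for `x n` and `(n, false)` for its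
inverse. -/
def eval (L : List (ℕ × Bool)) : ThompsonF :=
  (L.map fun p => if p.2 then x p.1 else (x p.1)⁻¹).prod

@[simp] theorem eval_nil : eval [] = 1 := rfl

@[simp] theorem eval_cons (p : ℕ × Bool) (L : List (ℕ × Bool)) :
    eval (p :: L) = (if p.2 then x p.1 else (x p.1)⁻¹) * eval L := by
  simp [eval]

@[simp] theorem eval_append (L M : List (ℕ × Bool)) : eval (L ++ M) = eval L * eval M := by
  simp [eval]

theorem eval_mem_rayFixer {m : ℕ} {L : List (ℕ × Bool)} (h : ∀ p ∈ L, m ≤ p.1) :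
    eval L ∈ rayFixer m := by
  refine Subgroup.list_prod_mem _ ?_
  simp only [List.mem_map]
  rintro _ ⟨p, hp, rfl⟩
  split_ifs
  · exact x_mem_rayFixer (h p hp)
  · exact inv_mem (x_mem_rayFixer (h p hp))

/-- Increase all indices of a word by one. -/
def shift (L : List (ℕ × Bool)) : List (ℕ × Bool) := L.map fun p => (p.1 + 1, p.2)

theorem eval_mul_x {m : ℕ} {L : List (ℕ × Bool)} (h : ∀ p ∈ L, m + 1 ≤ p.1) :
    eval L * x m = x m * eval (shift L) := by
  induction L with
  | nil => simp [shift]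
  | cons p L ih =>
    have hp : x p.1 * x m = x m * x (p.1 + 1) := x_mul_x (h p (by simp))
    have hL := ih fun q hq => h q (by simp [hq])
    simp only [shift, List.map_cons, eval_cons] at hL ⊢
    rw [mul_assoc, hL, ← mul_assoc, ← mul_assoc]
    congr 1
    split_ifs
    · exact hp
    · rw [inv_mul_eq_iff_eq_mul, ← mul_assoc, hp, mul_inv_cancel_right]

theorem exists_shift_eq {m : ℕ} {L : List (ℕ × Bool)} (h : ∀ p ∈ L, m + 1 ≤ p.1) :
    ∃ M, (∀ p ∈ M, m ≤ p.1) ∧ shift M = L := by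
  refine ⟨L.map fun p => (p.1 - 1, p.2), ?_, ?_⟩
  · simp only [List.mem_map]
    rintro _ ⟨p, hp, rfl⟩
    have := h p hp
    dsimp only
    omega
  · rw [shift, List.map_map]
    refine (List.map_congr_left fun p hp => ?_).trans (List.map_id L)
    have := h p hp
    ext
    · simp only [Function.comp, id]; omega
    · rfl

/-- On the right of `m`, a word in the letters of index at least `m` acts linearly, with slope
determined by the exponent sum of `x m`. -/
theorem eval_near {m : ℕ} {L : List (ℕ × Bool)} (h : ∀ p ∈ L, m ≤ p.1) :
    ∃ d : ℝ, 0 < d ∧ ∀ t, 0 ≤ t → t ≤ d → action (eval L) (m + t) =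
      m + 2 ^ ((L.count (m, false) : ℤ) - L.count (m, true)) * t := by
  induction L with
  | nil => exact ⟨1, one_pos, by simp⟩
  | cons p L ih =>
    obtain ⟨d, hd, hL⟩ := ih fun q hq => h q (by simp [hq])
    set e : ℤ := (L.count (m, false) : ℤ) - L.count (m, true) with he
    have hpos : (0 : ℝ) < 2 ^ e := by positivity
    refine ⟨min d (2 ^ e)⁻¹, by positivity, fun t ht0 ht => ?_⟩
    have hs0 : 0 ≤ 2 ^ e * t := by positivity
    have hs1 : 2 ^ e * t ≤ 1 := by
      have := mul_le_mul_of_nonneg_left (ht.trans (min_le_right _ _)) hpos.le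
      rwa [mul_inv_cancel₀ hpos.ne'] at this
    rw [eval_cons, map_mul, Equiv.Perm.mul_apply, hL t ht0 (ht.trans (min_le_left _ _))]
    obtain ⟨n, b⟩ := p
    have hn : m ≤ n := h _ List.mem_cons_self
    rcases hn.eq_or_lt with rfl | hlt
    · cases b
      · have h1 : ((((m, false) :: L).count (m, false) : ℕ) : ℤ) -
            (((m, false) :: L).count (m, true) : ℕ) = e + 1 := by
          simp [he]; ring
        rw [h1, zpow_add_one₀ two_ne_zero]
        simp only [Bool.false_eq_true, if_false, map_inv, action_x, contraction_inv_apply]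
        split_ifs <;> linarith
      · have h1 : ((((m, true) :: L).count (m, false) : ℕ) : ℤ) -
            (((m, true) :: L).count (m, true) : ℕ) = e - 1 := by
          simp [he]; ring
        rw [h1, zpow_sub_one₀ two_ne_zero]
        simp only [if_true, action_x, contraction_apply]
        split_ifs <;> linarith
    · have hc (b' : Bool) : ((n, b) :: L).count (m, b') = L.count (m, b') :=
        List.count_cons_of_ne (by simp [hlt.ne'])
      have hlt' : (m : ℝ) + 1 ≤ n := by exact_mod_cast hlt
      have hle : (m : ℝ) + 2 ^ e * t ≤ n := by linarith
      rw [hc, hc, ← he]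
      cases b <;> simp [action_x, contraction_apply, contraction_inv_apply, hle]

theorem count_eq_count {m : ℕ} {L : List (ℕ × Bool)} (h : ∀ p ∈ L, m ≤ p.1)
    (hL : eval L ∈ rayFixer (m + 1)) : L.count (m, true) = L.count (m, false) := by
  obtain ⟨d, hd, hd'⟩ := eval_near h
  have hmin : (0 : ℝ) < min d 1 := by positivity
  have h1 := hd' (min d 1) hmin.le (min_le_left _ _)
  rw [hL _ (by push_cast; linarith [min_le_right d 1])] at h1
  have h2 : (2 : ℝ) ^ ((L.count (m, false) : ℤ) - L.count (m, true)) = 1 :=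
    mul_right_cancel₀ hmin.ne' (by linarith)
  rw [zpow_eq_one_iff_right₀ (by norm_num) (by norm_num)] at h2
  omega

/-! ### Pinches -/

theorem exists_first_occurrence {m : ℕ} {b : Bool} {L : List (ℕ × Bool)}
    (h : ∀ p ∈ L, m ≤ p.1) (hb : (m, !b) ∉ L) (hm : (m, b) ∈ L) :
    ∃ u B, L = u ++ (m, b) :: B ∧ ∀ p ∈ u, m + 1 ≤ p.1 := by
  induction L with
  | nil => simp at hm
  | cons p L ih =>
    by_cases hp : p = (m, b)
    · exact ⟨[], L, by simp [hp], by simp⟩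
    · obtain ⟨u, B, rfl, hu⟩ := ih (fun q hq => h q (by simp [hq])) (fun hq => hb (by simp [hq]))
        ((List.mem_cons.mp hm).resolve_left (Ne.symm hp))
      refine ⟨p :: u, B, rfl, List.forall_mem_cons.mpr ⟨?_, hu⟩⟩
      refine (h p List.mem_cons_self).lt_of_ne ?_
      rintro rfl
      obtain hpb | hpb := Bool.eq_or_eq_not p.2 b
      · exact hp (Prod.ext rfl hpb)
      · exact hb (by simp [← hpb])

theorem exists_last_occurrence {m : ℕ} {b : Bool} {L : List (ℕ × Bool)}
    (h : ∀ p ∈ L, m ≤ p.1) (hb : (m, !b) ∉ L) (hm : (m, b) ∈ L) :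
    ∃ A v, L = A ++ (m, b) :: v ∧ ∀ p ∈ v, m + 1 ≤ p.1 := by
  obtain ⟨u, B, h1, hu⟩ := exists_first_occurrence (L := L.reverse) (by simpa using h)
    (by simpa using hb) (by simpa using hm)
  refine ⟨B.reverse, u.reverse, ?_, by simpa using hu⟩
  rw [← L.reverse_reverse, h1]
  simp

theorem pinch_or_split {m : ℕ} {L : List (ℕ × Bool)} (h : ∀ p ∈ L, m ≤ p.1) :
    (∃ A u B, L = A ++ (m, false) :: u ++ (m, true) :: B ∧ ∀ p ∈ u, m + 1 ≤ p.1) ∨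
      ∃ P N, L = P ++ N ∧ (m, false) ∉ P ∧ (m, true) ∉ N := by
  induction L with
  | nil => exact .inr ⟨[], [], by simp⟩
  | cons p L ih =>
    rcases ih fun q hq => h q (by simp [hq]) with ⟨A, u, B, rfl, hu⟩ | ⟨P, N, rfl, hP, hN⟩
    · exact .inl ⟨p :: A, u, B, by simp, hu⟩
    · by_cases hp : p = (m, false)
      · subst hp
        by_cases hm : (m, true) ∈ P
        · obtain ⟨u, B, rfl, hu⟩ := exists_first_occurrence
            (fun q hq => h q (by simp [hq])) hP hm
          exact .inl ⟨[], u, B ++ N, by simp, hu⟩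
        · exact .inr ⟨[], (m, false) :: (P ++ N), by simp, by simp, by simp [hm, hN]⟩
      · exact .inr ⟨p :: P, N, by simp, by simp [hP, Ne.symm hp], hN⟩

theorem exists_pinch_of_split {m : ℕ} (P N : List (ℕ × Bool)) (h : ∀ p ∈ P ++ N, m ≤ p.1)
    (hP : (m, false) ∉ P) (hN : (m, true) ∉ N) (hmem : eval (P ++ N) ∈ rayFixer (m + 1))
    (hm : ∃ b, (m, b) ∈ P ++ N) :
    ∃ A u B, P ++ N = A ++ (m, true) :: u ++ (m, false) :: B ∧ (∀ p ∈ u, m + 1 ≤ p.1) ∧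
      eval u ∈ rayFixer (m + 2) := by
  induction hlen : P.length using Nat.strong_induction_on generalizing P N with
  | _ l ih =>
  have hcount := count_eq_count h hmem
  rw [List.count_append, List.count_append, List.count_eq_zero.mpr hP,
    List.count_eq_zero.mpr hN, add_zero, zero_add] at hcount
  have hmP : (m, true) ∈ P := by
    rw [← List.count_pos_iff]
    obtain ⟨b, hb⟩ := hm
    rcases List.mem_append.mp hb with hb | hb <;> cases b
    · exact absurd hb hP
    · exact List.count_pos_iff.mpr hb
    · exact hcount ▸ List.count_pos_iff.mpr hb
    · exact absurd hb hN
  have hmN : (m, false) ∈ N := by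
    rw [← List.count_pos_iff, ← hcount]
    exact List.count_pos_iff.mpr hmP
  obtain ⟨u, P', rfl, hu⟩ := exists_first_occurrence (fun q hq => h q (by simp [hq])) hP hmP
  obtain ⟨N', v, rfl, hv⟩ := exists_last_occurrence (fun q hq => h q (by simp [hq])) hN hmN
  have h' : ∀ p ∈ P' ++ N', m ≤ p.1 := fun q hq => h q (by
    rcases List.mem_append.mp hq with hq | hq <;> simp [hq])
  have hinner : eval (P' ++ N') ∈ rayFixer (m + 2) := by
    refine mem_rayFixer_of_conj_mem ?_
    have := mul_mem (mul_mem (inv_mem (eval_mem_rayFixer hu)) hmem)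
      (inv_mem (eval_mem_rayFixer hv))
    simpa [mul_assoc] using this
  by_cases hm' : ∃ b, (m, b) ∈ P' ++ N'
  · obtain ⟨A, w, B, hw, hw'⟩ := ih P'.length (by simp at hlen; omega) P' N' h'
      (fun hq => hP (by simp [hq])) (fun hq => hN (by simp [hq]))
      (rayFixer_antitone (by omega) hinner) hm' rfl
    refine ⟨u ++ (m, true) :: A, w, B ++ (m, false) :: v, ?_, hw'⟩
    calc (u ++ (m, true) :: P') ++ (N' ++ (m, false) :: v)
        = u ++ (m, true) :: ((P' ++ N') ++ (m, false) :: v) := by simp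
      _ = _ := by rw [hw]; simp
  · refine ⟨u, P' ++ N', v, by simp, fun p hp => ?_, hinner⟩
    refine (h' p hp).lt_of_ne ?_
    rintro rfl
    exact hm' ⟨p.2, hp⟩

/-! ### Alternating words -/

/-- The parities of the indices of the word alternate; the first index has parity `a`, and a
further index could be appended precisely if it has parity `b`. -/
def Alternates : Bool → Bool → List (ℕ × Bool) → Prop
  | a, b, [] => a = b
  | a, b, p :: L => p.1.bodd = a ∧ Alternates (!a) b L

theorem alternates_append {a b : Bool} {L M : List (ℕ × Bool)} :
    Alternates a b (L ++ M) ↔ ∃ c, Alternates a c L ∧ Alternates c b M := by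
  induction L generalizing a with
  | nil => simp [Alternates]
  | cons p L ih => simp [Alternates, ih, and_assoc]

theorem alternates_shift {a b : Bool} {L : List (ℕ × Bool)} :
    Alternates (!a) (!b) (shift L) ↔ Alternates a b L := by
  induction L generalizing a with
  | nil => simp [shift, Alternates]
  | cons p L ih =>
    simp only [shift, List.map_cons, Alternates, Nat.bodd_succ] at ih ⊢
    rw [ih]
    simp

theorem Alternates.ne_nil {a : Bool} {L : List (ℕ × Bool)} (h : Alternates a (!a) L) :
    L ≠ [] := by
  rintro rfl
  simp [Alternates] at h

theorem alternates_pinch {a b c d : Bool} {m : ℕ} {A u B : List (ℕ × Bool)}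
    (h : Alternates a b (A ++ (m, c) :: u ++ (m, d) :: B)) :
    Alternates a m.bodd A ∧ Alternates (!m.bodd) m.bodd u ∧ Alternates (!m.bodd) b B := by
  simp only [alternates_append, Alternates] at h
  obtain ⟨_, ⟨_, hA, rfl, hu⟩, rfl, hB⟩ := h
  exact ⟨hA, hu, hB⟩

theorem exists_shorter_of_exists_lift {m : ℕ} {a b : Bool} {L : List (ℕ × Bool)}
    (lift : ∀ u : List (ℕ × Bool), u.length < L.length → ∀ a b, Alternates a b u →
      (∀ p ∈ u, m + 1 ≤ p.1) → eval u ∈ rayFixer (m + 2) →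
      ∃ v, v.length ≤ u.length ∧ Alternates a b v ∧ (∀ p ∈ v, m + 2 ≤ p.1) ∧ eval v = eval u)
    (hL : Alternates a b L) (h : ∀ p ∈ L, m ≤ p.1) (hm : ∃ e, (m, e) ∈ L)
    (hmem : eval L ∈ rayFixer (m + 1)) :
    ∃ M, M.length < L.length ∧ M ≠ [] ∧ Alternates a b M ∧ (∀ p ∈ M, m ≤ p.1) ∧
      eval M = eval L := by
  rcases pinch_or_split h with ⟨A, u, B, rfl, hu⟩ | ⟨P, N, rfl, hP, hN⟩
  · obtain ⟨hA, hu', hB⟩ := alternates_pinch hL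
    have hs : Alternates m.bodd (!m.bodd) (shift u) := by simpa using alternates_shift.mpr hu'
    refine ⟨A ++ shift u ++ B, by simp [shift], by simp [hs.ne_nil],
      alternates_append.mpr ⟨_, alternates_append.mpr ⟨_, hA, hs⟩, hB⟩, fun p hp => ?_, ?_⟩
    · simp only [List.mem_append, shift, List.mem_map] at hp
      rcases hp with (hp | ⟨q, hq, rfl⟩) | hp
      · exact h p (by simp [hp])
      · have := hu q hq
        dsimp only
        omega
      · exact h p (by simp [hp])
    · have : eval (shift u) = (x m)⁻¹ * (eval u * x m) := by
        rw [eval_mul_x hu, inv_mul_cancel_left]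
      simp [this, mul_assoc]
  · obtain ⟨A, u, B, hL', hu, hu'⟩ := exists_pinch_of_split P N h hP hN hmem hm
    rw [hL'] at lift hL h ⊢
    obtain ⟨hA, hau, hB⟩ := alternates_pinch hL
    obtain ⟨v, hv, hav, hvm, hvu⟩ := lift u (by simp; omega) _ _ hau hu hu'
    obtain ⟨w, hw, rfl⟩ := exists_shift_eq hvm
    have hs : Alternates m.bodd (!m.bodd) w := by
      rw [← alternates_shift]; simpa using hav
    refine ⟨A ++ w ++ B, ?_, by simp [hs.ne_nil],
      alternates_append.mpr ⟨_, alternates_append.mpr ⟨_, hA, hs⟩, hB⟩, fun p hp => ?_, ?_⟩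
    · simp [shift] at hv ⊢
      omega
    · simp only [List.mem_append] at hp
      rcases hp with (hp | hp) | hp
      · exact h p (by simp [hp])
      · exact (Nat.le_succ m).trans (hw p hp)
      · exact h p (by simp [hp])
    · have : eval w = x m * eval u * (x m)⁻¹ := by
        rw [← hvu, ← eval_mul_x hw, mul_inv_cancel_right]
      simp [this, mul_assoc]

theorem exists_alternating_lift {m : ℕ} {a b : Bool} {L : List (ℕ × Bool)}
    (hL : Alternates a b L) (h : ∀ p ∈ L, m ≤ p.1) (hmem : eval L ∈ rayFixer (m + 1)) :
    ∃ M, M.length ≤ L.length ∧ Alternates a b M ∧ (∀ p ∈ M, m + 1 ≤ p.1) ∧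
      eval M = eval L := by
  induction hlen : L.length using Nat.strong_induction_on generalizing m a b L with
  | _ l ih =>
  subst hlen
  by_cases hm : ∃ e, (m, e) ∈ L
  · obtain ⟨M, hML, -, hM, hMm, hev⟩ := exists_shorter_of_exists_lift
      (fun u hu _ _ hau hum hu' => ih _ hu hau hum hu' rfl) hL h hm hmem
    obtain ⟨M', hM', h1, h2, h3⟩ := ih _ hML hM hMm (hev ▸ hmem) rfl
    exact ⟨M', by omega, h1, h2, h3.trans hev⟩
  · refine ⟨L, le_rfl, hL, fun p hp => (h p hp).lt_of_ne ?_, rfl⟩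
    rintro rfl
    exact hm ⟨p.2, hp⟩

theorem eval_ne_one {a b : Bool} {L : List (ℕ × Bool)} (hL : Alternates a b L) (hne : L ≠ []) :
    eval L ≠ 1 := by
  induction hlen : L.length using Nat.strong_induction_on generalizing L with
  | _ l ih =>
  subst hlen
  intro h1
  obtain ⟨p, hp, hmin⟩ := L.toFinset.exists_min_image Prod.fst
    (by simpa [Finset.nonempty_iff_ne_empty] using hne)
  simp only [List.mem_toFinset] at hp hmin
  obtain ⟨M, hML, hM0, hM, -, hev⟩ := exists_shorter_of_exists_lift
    (fun _ _ _ _ hau hum hu' => exists_alternating_lift hau hum hu') hL hmin ⟨p.2, hp⟩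
    (h1 ▸ one_mem _)
  exact ih _ hML hM hM0 rfl (hev.trans h1)

theorem exists_alternating_eval_eq_prod {l : List ThompsonF}
    (h : ∀ g ∈ l, ∃ p q : ℕ × Bool, Even p.1 ∧ Odd q.1 ∧ g = eval [p, q]) :
    ∃ L, Alternates false false L ∧ l.length ≤ L.length ∧ eval L = l.prod := by
  induction l with
  | nil => exact ⟨[], rfl, le_rfl, rfl⟩
  | cons g l ih =>
    obtain ⟨L, hL, hlen, hev⟩ := ih fun g' hg' => h g' (by simp [hg'])
    obtain ⟨p, q, hp, hq, rfl⟩ := h g (by simp)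
    refine ⟨p :: q :: L, ⟨?_, ?_, by simpa using hL⟩, by simp; omega, by simp [hev, mul_assoc]⟩
    · simpa [Nat.even_iff, Nat.mod_two_of_bodd] using hp
    · simpa [Nat.odd_iff, Nat.mod_two_of_bodd] using hq

theorem exists_bool_eq_zpow (n : ℕ) {e : ℤ} (he : e = 1 ∨ e = -1) :
    ∃ c : Bool, x n ^ e = eval [(n, c)] := by
  rcases he with rfl | rfl
  · exact ⟨true, by simp⟩
  · exact ⟨false, by simp⟩

end ThompsonF

/-- In Thompson's group `F`, no word `x_{i₁}^{ε₁} x_{j₁}^{δ₁} ⋯ x_{i_k}^{ε_k} x_{j_k}^{δ_k}`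
with `k ≥ 1`, all `i_l` even, all `j_l` odd and all exponents `±1`, represents the identity. -/
theorem thompson_no_alternating_parity_relation
    (k : ℕ) (hk : 1 ≤ k) (i j : Fin k → ℕ)
    (hi : ∀ l, Even (i l)) (hj : ∀ l, Odd (j l))
    (ε δ : Fin k → ℤ)
    (hε : ∀ l, ε l = 1 ∨ ε l = -1) (hδ : ∀ l, δ l = 1 ∨ δ l = -1) :
    (List.ofFn (fun l : Fin k => x (i l) ^ (ε l) * x (j l) ^ (δ l))).prod ≠ 1 := by
  obtain ⟨L, hL, hlen, hev⟩ := ThompsonF.exists_alternating_eval_eq_prod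
    (l := List.ofFn fun l : Fin k => x (i l) ^ (ε l) * x (j l) ^ (δ l)) <| by
      simp only [List.mem_ofFn]
      rintro _ ⟨l, rfl⟩
      obtain ⟨c, hc⟩ := ThompsonF.exists_bool_eq_zpow (i l) (hε l)
      obtain ⟨d, hd⟩ := ThompsonF.exists_bool_eq_zpow (j l) (hδ l)
      exact ⟨(i l, c), (j l, d), hi l, hj l, by rw [hc, hd, ← ThompsonF.eval_append]; rfl⟩
  rw [← hev]
  refine ThompsonF.eval_ne_one hL ?_
  rintro rfl
  rw [List.length_ofFn, List.length_nil] at hlen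
  omega
end

section
/- Let F be R. Thompson's group, presented on generators x₀, x₁, x₂, … with defining relations x_j x_i = x_i x_{j+1} for 0 ≤ i < j, and set a = x₀ and b = x₁. Then for every integer k ≥ 1 and all signs ε₁, δ₁, …, ε_k, δ_k ∈ {1, −1}, the element a^{ε₁} b^{δ₁} ⋯ a^{ε_k} b^{δ_k} is not the identity of F; that is, F admits no relation of the form x₀^{±1} x₁^{±1} ⋯ x₀^{±1} x₁^{±1} = 1. -/
namespace ThompsonWalk

open Equiv

theorem x_mul_x {i j : ℕ} (h : i < j) : x j * x i = x i * x (j + 1) := by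
  have : (PresentedGroup.mk thompsonRels (FreeGroup.of j * FreeGroup.of i *
      (FreeGroup.of (j + 1))⁻¹ * (FreeGroup.of i)⁻¹)) = 1 :=
    PresentedGroup.one_of_mem ⟨i, j, h, rfl⟩
  simp only [map_mul, map_inv] at this
  have h2 : x j * x i * (x (j + 1))⁻¹ * (x i)⁻¹ = 1 := this
  rw [mul_inv_eq_one, mul_inv_eq_iff_eq_mul] at h2
  exact h2

theorem x_conj_zpow {i j : ℕ} (h : i < j) (e : ℤ) :
    (x i)⁻¹ * x j ^ e * x i = x (j + 1) ^ e := by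
  have h1 : x (j + 1) = (x i)⁻¹ * x j * ((x i)⁻¹)⁻¹ := by
    rw [inv_inv, mul_assoc, x_mul_x h, inv_mul_cancel_left]
  rw [h1, conj_zpow, inv_inv]

/-- A self-doubling of `ℤ ⊕ ℕ` whose left half carries the translation `z ↦ z + 1` of `ℤ`. -/
noncomputable def doubling : ℤ ⊕ ℕ ≃ (ℤ ⊕ ℕ) ⊕ (ℤ ⊕ ℕ) :=
  (Equiv.sumCongr (Equiv.addRight (1 : ℤ)) (Denumerable.equiv₂ ℕ (ℕ ⊕ (ℤ ⊕ ℕ)))).trans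
    (Equiv.sumAssoc ℤ ℕ (ℤ ⊕ ℕ)).symm

theorem doubling_inl (z : ℤ) : doubling (Sum.inl z) = Sum.inl (Sum.inl (z + 1)) := rfl

/-- The permutation of `ℕ × (ℤ ⊕ ℕ)` which fixes the levels below `n`, doubles level `n` onto the
levels `n`, `n + 1`, and shifts all levels above `n` by one. -/
noncomputable def expand (n : ℕ) : Perm (ℕ × (ℤ ⊕ ℕ)) where
  toFun p := if p.1 < n then p else if p.1 = n then
    Sum.elim (fun t => (n, t)) (fun t => (n + 1, t)) (doubling p.2) else (p.1 + 1, p.2)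
  invFun p := if p.1 < n then p else if p.1 = n then (n, doubling.symm (Sum.inl p.2)) else
    if p.1 = n + 1 then (n, doubling.symm (Sum.inr p.2)) else (p.1 - 1, p.2)
  left_inv := by
    rintro ⟨p, s⟩
    rcases lt_trichotomy p n with h | rfl | h
    · simp [h]
    · rcases hs : doubling s with t | t <;> simp [hs, Equiv.symm_apply_eq]
    · have h1 : ¬ p < n := by omega
      have h2 : p ≠ n := by omega
      have h3 : ¬ p + 1 < n := by omega
      have h4 : p + 1 ≠ n := by omega
      simp [h1, h2, h3, h4]
  right_inv := by
    rintro ⟨p, s⟩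
    rcases lt_trichotomy p n with h | rfl | h
    · simp [h]
    · simp
    · have h1 : ¬ p < n := by omega
      have h2 : p ≠ n := by omega
      by_cases h3 : p = n + 1
      · subst h3; simp
      · have h4 : ¬ p - 1 < n := by omega
        have h5 : p - 1 ≠ n := by omega
        have h6 : p - 1 + 1 = p := by omega
        simp [h1, h2, h3, h4, h5, h6]

theorem expand_apply_of_lt {p n : ℕ} (h : p < n) (s : ℤ ⊕ ℕ) : expand n (p, s) = (p, s) := by
  simp [expand, h]

theorem expand_apply_of_gt {p n : ℕ} (h : n < p) (s : ℤ ⊕ ℕ) :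
    expand n (p, s) = (p + 1, s) := by
  have h1 : ¬ p < n := by omega
  have h2 : p ≠ n := by omega
  simp [expand, h1, h2]

theorem expand_apply_self (n : ℕ) (s : ℤ ⊕ ℕ) :
    expand n (n, s) = Sum.elim (fun t => (n, t)) (fun t => (n + 1, t)) (doubling s) := by
  simp [expand]

theorem expand_mul_expand {i j : ℕ} (h : i < j) :
    expand i * expand j = expand (j + 1) * expand i := by
  ext1 ⟨p, s⟩
  rw [Perm.mul_apply, Perm.mul_apply]
  rcases lt_trichotomy p i with hp | rfl | hp
  · rw [expand_apply_of_lt (hp.trans h), expand_apply_of_lt hp, expand_apply_of_lt (by omega)]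
  · rw [expand_apply_of_lt h, expand_apply_self]
    rcases doubling s with t | t <;> simp only [Sum.elim_inl, Sum.elim_inr] <;>
      rw [expand_apply_of_lt (by omega)]
  · rw [expand_apply_of_gt hp]
    rcases lt_trichotomy p j with hq | rfl | hq
    · rw [expand_apply_of_lt hq, expand_apply_of_gt hp, expand_apply_of_lt (by omega)]
    · rw [expand_apply_self, expand_apply_self]
      rcases doubling s with t | t <;> simp only [Sum.elim_inl, Sum.elim_inr] <;>
        rw [expand_apply_of_gt (by omega)]
    · rw [expand_apply_of_gt hq, expand_apply_of_gt (by omega), expand_apply_of_gt (by omega)]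

/-- The action of Thompson's group in which `x n` acts by the inverse of `expand n`. -/
noncomputable def action : ThompsonF →* Perm (ℕ × (ℤ ⊕ ℕ)) :=
  PresentedGroup.toGroup (f := fun n => (expand n)⁻¹) (by
    rintro r ⟨i, j, h, rfl⟩
    simp only [map_mul, map_inv, FreeGroup.lift_apply_of]
    rw [mul_inv_eq_one, mul_inv_eq_iff_eq_mul, ← mul_inv_rev, ← mul_inv_rev,
      expand_mul_expand h])

theorem action_x (n : ℕ) : action (x n) = (expand n)⁻¹ := PresentedGroup.toGroup.of _

/-- The element of Thompson's group spelled by a list of letters `(n, e)`, read as `x n ^ e`. -/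
def val (L : List (ℕ × ℤ)) : ThompsonF := (L.map fun p => x p.1 ^ p.2).prod

theorem val_cons (p : ℕ × ℤ) (L : List (ℕ × ℤ)) : val (p :: L) = x p.1 ^ p.2 * val L := by
  simp [val]

theorem val_append (L M : List (ℕ × ℤ)) : val (L ++ M) = val L * val M := by
  simp [val]

theorem val_append_comm_eq_one {L M : List (ℕ × ℤ)} (h : val (L ++ M) = 1) :
    val (M ++ L) = 1 := by
  rw [val_append] at h ⊢
  rwa [mul_eq_one_iff_eq_inv, eq_comm, inv_eq_iff_mul_eq_one] at h

/-- The total exponent of `x m` in a list of letters. -/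
def exponent (m : ℕ) (L : List (ℕ × ℤ)) : ℤ := (L.map fun p => if p.1 = m then p.2 else 0).sum

theorem action_letter {m n : ℕ} (h : m ≤ n) {e : ℤ} (he : e = 1 ∨ e = -1) (z : ℤ) :
    action (x n ^ e) (m, Sum.inl z) = (m, Sum.inl (z - if n = m then e else 0)) := by
  have key : ∀ z : ℤ, expand n (m, Sum.inl z) = (m, Sum.inl (z + if n = m then 1 else 0)) := by
    intro z
    rcases h.lt_or_eq with h | rfl
    · rw [expand_apply_of_lt h, if_neg h.ne', add_zero]
    · rw [expand_apply_self, doubling_inl, if_pos rfl]; rfl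
  rcases he with rfl | rfl
  · rw [zpow_one, action_x, Perm.inv_eq_iff_eq, key, sub_add_cancel]
  · rw [zpow_neg_one, map_inv, action_x, inv_inv, key]
    split_ifs <;> simp

theorem action_val {m : ℕ} {L : List (ℕ × ℤ)} (hm : ∀ p ∈ L, m ≤ p.1)
    (hs : ∀ p ∈ L, p.2 = 1 ∨ p.2 = -1) (z : ℤ) :
    action (val L) (m, Sum.inl z) = (m, Sum.inl (z - exponent m L)) := by
  induction L with
  | nil => simp [val, exponent]
  | cons p L ih =>
    rw [val_cons, map_mul, Perm.mul_apply,
      ih (fun q hq => hm q (by simp [hq])) (fun q hq => hs q (by simp [hq])),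
      action_letter (hm p (by simp)) (hs p (by simp))]
    simp only [exponent, List.map_cons, List.sum_cons]
    congr 2
    ring

/-- If a word in the generators of index at least `m` is trivial, its exponent of `x m` is zero. -/
theorem exponent_eq_zero {m : ℕ} {L : List (ℕ × ℤ)} (hm : ∀ p ∈ L, m ≤ p.1)
    (hs : ∀ p ∈ L, p.2 = 1 ∨ p.2 = -1) (h : val L = 1) : exponent m L = 0 := by
  have := action_val hm hs 0
  rw [h, map_one, Perm.one_apply] at this
  simpa using this

/-- Two letters are adjacent if their indices differ by exactly one. -/
def Adj (p q : ℕ × ℤ) : Prop := q.1 = p.1 + 1 ∨ p.1 = q.1 + 1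

/-- Raise the index of a letter by one. -/
def raise (p : ℕ × ℤ) : ℕ × ℤ := (p.1 + 1, p.2)

theorem conj_val {m : ℕ} {U : List (ℕ × ℤ)} (hU : ∀ p ∈ U, m < p.1) :
    (x m)⁻¹ * val U * x m = val (U.map raise) := by
  induction U with
  | nil => simp [val]
  | cons p U ih =>
    rw [List.map_cons, val_cons, val_cons, ← ih fun q hq => hU q (by simp [hq])]
    simp only [raise]
    rw [← x_conj_zpow (hU p (by simp))]
    group

theorem exponent_pos {m : ℕ} {σ : ℤ} {L : List (ℕ × ℤ)} (hs : ∀ p ∈ L, p.2 = 1 ∨ p.2 = -1)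
    (hσ : (m, -σ) ∉ L) (hp : ∃ p ∈ L, p.1 = m) (hσ1 : σ = 1 ∨ σ = -1) :
    0 < σ * exponent m L := by
  have nonneg : ∀ q ∈ L, 0 ≤ σ * if q.1 = m then q.2 else 0 := by
    rintro ⟨n, e⟩ hq
    have := hs _ hq
    dsimp only at this ⊢
    split_ifs with hn
    · subst hn
      rcases hσ1 with rfl | rfl <;> rcases this with rfl | rfl <;> simp_all
    · simp
  obtain ⟨p, hp, rfl⟩ := hp
  rw [exponent, ← List.sum_map_mul_left]
  have hle := List.single_le_sum (l := L.map fun q => σ * if q.1 = p.1 then q.2 else 0)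
    (fun y hy => by obtain ⟨q, hq, rfl⟩ := List.mem_map.1 hy; exact nonneg q hq) _
    (List.mem_map_of_mem hp)
  refine lt_of_lt_of_le ?_ hle
  refine lt_of_le_of_ne (nonneg p hp) ?_
  have := hs p hp
  rw [if_pos rfl]
  rcases hσ1 with rfl | rfl <;> rcases this with h | h <;> simp [h]

/-- A list containing both letters `(m, 1)` and `(m, -1)` has a rotation of the form
`(m, -1) :: U ++ (m, 1) :: B` with neither letter in `U`. -/
theorem exists_rotation {m : ℕ} {L : List (ℕ × ℤ)} (h1 : (m, 1) ∈ L) (h2 : (m, -1) ∈ L) :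
    ∃ U B : List (ℕ × ℤ), L ~r ((m, -1) :: U ++ (m, 1) :: B) ∧ (m, 1) ∉ U ∧ (m, -1) ∉ U := by
  obtain ⟨P, Q, rfl⟩ := List.append_of_mem h2
  have hmem : (m, (1 : ℤ)) ∈ Q ++ P := by
    simp only [List.mem_append, List.mem_cons, Prod.mk.injEq] at h1 ⊢
    rcases h1 with h | ⟨-, h⟩ | h
    · exact Or.inr h
    · norm_num at h
    · exact Or.inl h
  obtain ⟨R, B, hRB, hR⟩ := List.eq_append_cons_of_mem hmem
  obtain ⟨V, A, hVA, hV⟩ := List.eq_append_cons_of_mem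
    (show (m, (-1 : ℤ)) ∈ ((m, (-1 : ℤ)) :: R).reverse by simp)
  have hRA : (m, (-1 : ℤ)) :: R = A.reverse ++ (m, -1) :: V.reverse := by
    rw [← List.reverse_reverse (_ :: R), hVA]
    simp
  refine ⟨V.reverse, B ++ A.reverse, ?_, ?_, by simpa using hV⟩
  · have e1 : P ++ (m, -1) :: Q ~r ((m, -1) :: Q) ++ P := List.isRotated_append
    refine e1.trans ?_
    rw [List.cons_append, hRB, ← List.cons_append, hRA, List.append_assoc]
    refine List.isRotated_append.trans ?_
    simp [List.IsRotated.refl]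
  · intro h
    have : (m, (1 : ℤ)) ∈ (m, (-1 : ℤ)) :: R := by rw [hRA]; simp [List.mem_reverse.1 h]
    simp only [List.mem_cons, Prod.mk.injEq] at this
    rcases this with ⟨-, h⟩ | h
    · norm_num at h
    · exact hR h

theorem isChain_replace_last {α : Type*} {r : α → α → Prop} {l : List α} {y z : α}
    (h : List.IsChain r (l ++ [y])) (hyz : ∀ p ∈ l, r p y → r p z) :
    List.IsChain r (l ++ [z]) := by
  simp only [List.isChain_append, List.head?_cons, Option.mem_some_iff, forall_eq',
    List.isChain_singleton, true_and] at h ⊢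
  exact ⟨h.1, fun p hp => hyz p (List.mem_of_mem_getLast? hp) (h.2 p hp)⟩

/-- Raising a segment lying strictly above level `m` between two letters of index `m` and deleting
these letters preserves closed walks. -/
theorem chain_raise {m : ℕ} {d e : ℤ} {U B : List (ℕ × ℤ)}
    (hU : ∀ p ∈ U, m < p.1) (hB : ∀ p ∈ B, m ≤ p.1)
    (h : Cycle.Chain Adj ((m, d) :: U ++ (m, e) :: B : List (ℕ × ℤ))) :
    U ≠ [] ∧ Cycle.Chain Adj (U.map raise ++ B : List (ℕ × ℤ)) := by
  rw [List.cons_append, Cycle.chain_coe_cons] at h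
  rcases U with _ | ⟨u, U⟩
  · simp [Adj] at h
  rcases B with _ | ⟨b, B⟩
  · rw [List.append_assoc, List.singleton_append, List.isChain_cons_append_cons_cons] at h
    simp [Adj] at h
  refine ⟨by simp, ?_⟩
  rw [List.append_assoc, List.cons_append (bs := [(m, d)]), List.isChain_cons_split,
    List.cons_append, List.isChain_cons_cons, List.cons_append, List.isChain_cons_cons] at h
  obtain ⟨⟨hmu, hUc⟩, hmb, hBc⟩ := h
  have hu : u.1 = m + 1 := by
    have := hU u (by simp)
    simp only [Adj] at hmu
    omega
  have hb : b.1 = m + 1 := by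
    have := hB b (by simp)
    simp only [Adj] at hmb
    omega
  rw [List.map_cons, List.cons_append, Cycle.chain_coe_cons, List.append_assoc, List.cons_append,
    List.isChain_cons_split]
  constructor
  · have hUr : List.IsChain Adj ((u :: U).map raise ++ [raise (m, e)]) := by
      have := List.isChain_map_of_isChain (S := Adj) raise
        (fun p q hpq => by simp only [Adj, raise] at hpq ⊢; omega) hUc
      simpa using this
    refine isChain_replace_last hUr fun p hp hpm => ?_
    obtain ⟨q, hq, rfl⟩ := List.mem_map.1 hp
    have := hU q hq
    simp only [Adj, raise] at hpm ⊢
    omega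
  · refine isChain_replace_last (l := b :: B) hBc fun p hp hpm => ?_
    have := hB p hp
    simp only [Adj, raise] at hpm ⊢
    omega

/-- A nonempty closed walk in the indices never spells the identity. -/
theorem val_ne_one {L : List (ℕ × ℤ)} (hne : L ≠ []) (hs : ∀ p ∈ L, p.2 = 1 ∨ p.2 = -1)
    (hc : Cycle.Chain Adj (L : Cycle (ℕ × ℤ))) : val L ≠ 1 := by
  induction hN : L.length using Nat.strong_induction_on generalizing L with
  | _ N ih =>
    intro hval
    obtain ⟨⟨m, s⟩, hp, hmin⟩ : ∃ p ∈ L, ∀ q ∈ L, p.1 ≤ q.1 := by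
      obtain ⟨p, hp, h⟩ := L.toFinset.exists_min_image Prod.fst
        (by rwa [List.toFinset_nonempty_iff])
      exact ⟨p, by simpa using hp, fun q hq => h q (by simpa using hq)⟩
    dsimp only at hmin
    have h0 := exponent_eq_zero hmin hs hval
    have h1 : (m, (1 : ℤ)) ∈ L := by
      by_contra hn
      have := exponent_pos (σ := -1) hs (by simpa using hn) ⟨_, hp, rfl⟩ (by simp)
      simp [h0] at this
    have h2 : (m, (-1 : ℤ)) ∈ L := by
      by_contra hn
      have := exponent_pos (σ := 1) hs hn ⟨_, hp, rfl⟩ (by simp)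
      simp [h0] at this
    obtain ⟨U, B, hrot, hU1, hU2⟩ := exists_rotation h1 h2
    have hmem : ∀ q ∈ (m, -1) :: U ++ (m, 1) :: B, q ∈ L := fun q hq => hrot.mem_iff.2 hq
    have hU : ∀ q ∈ U, m < q.1 := by
      rintro ⟨n, e⟩ hq
      have hqL := hmem (n, e) (by simp [hq])
      refine lt_of_le_of_ne (hmin _ hqL) ?_
      rintro rfl
      rcases hs _ hqL with h | h <;> dsimp only at h <;> subst h <;> contradiction
    rw [Cycle.coe_eq_coe.2 hrot] at hc
    obtain ⟨hUne, hc'⟩ := chain_raise hU (fun q hq => hmin _ (hmem q (by simp [hq]))) hc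
    have hlen := hrot.perm.length_eq
    refine ih _ ?_ (by simpa using fun h => absurd h hUne) ?_ hc' rfl ?_
    · simp at hlen ⊢
      omega
    · intro q hq
      rcases List.mem_append.1 hq with hq | hq
      · obtain ⟨t, ht, rfl⟩ := List.mem_map.1 hq
        exact hs t (hmem t (by simp [ht]))
      · exact hs q (hmem q (by simp [hq]))
    · obtain ⟨n, hn⟩ := hrot
      rw [← List.take_append_drop (n % L.length) L] at hval
      have := val_append_comm_eq_one hval
      rw [← List.rotate_eq_drop_append_take_mod, hn] at this
      rw [val_append, ← conj_val hU]
      simpa [val_append, val_cons, mul_assoc] using this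

theorem x_zero_zpow_mul (n : ℕ) (f : ℤ) :
    x 0 ^ (-n : ℤ) * x 1 ^ f = x (n + 1) ^ f * x 0 ^ (-n : ℤ) := by
  induction n with
  | zero => simp
  | succ n ih =>
    have h : x 0 ^ (-(n + 1 : ℕ) : ℤ) = (x 0)⁻¹ * x 0 ^ (-n : ℤ) := by
      rw [← zpow_neg_one, ← zpow_add]
      congr 1
      push_cast
      ring
    rw [h, mul_assoc, ih, ← x_conj_zpow n.succ_pos]
    simp only [mul_assoc, mul_inv_cancel_left]

/-- Moving all powers of `x 0` to the right turns an alternating word into a word in the `x n` with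
`1 ≤ n` whose indices form a walk. -/
theorem exists_walk (l : List (ℤ × ℤ)) (hl : ∀ p ∈ l, (p.1 = 1 ∨ p.1 = -1) ∧ (p.2 = 1 ∨ p.2 = -1))
    (c : ℕ) (hc : l.length ≤ c) :
    ∃ (W : List (ℕ × ℤ)) (c' : ℕ), (c' : ℤ) = c - (l.map Prod.fst).sum ∧
      x 0 ^ (-c : ℤ) * (l.map fun p => x 0 ^ p.1 * x 1 ^ p.2).prod = val W * x 0 ^ (-c' : ℤ) ∧
      W.length = l.length ∧ (∀ p ∈ W, p.2 = 1 ∨ p.2 = -1) ∧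
      ∀ d y, Adj (c' + 1, d) y → List.IsChain Adj ((c + 1, d) :: (W ++ [y])) := by
  induction l generalizing c with
  | nil => exact ⟨[], c, by simp, by simp [val], rfl, by simp, fun d y h => by simpa using h⟩
  | cons p l ih =>
    obtain ⟨e, f⟩ := p
    obtain ⟨he, hf⟩ := hl (e, f) (by simp)
    dsimp only at he hf
    rw [List.length_cons] at hc
    obtain ⟨n, hn⟩ : ∃ n : ℕ, (n : ℤ) = c - e := ⟨(c - e).toNat, by omega⟩
    obtain ⟨W, c', h1, h2, h3, h4, h5⟩ := ih (fun q hq => hl q (by simp [hq])) n (by omega)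
    refine ⟨(n + 1, f) :: W, c', ?_, ?_, by simp [h3], ?_, ?_⟩
    · simp only [List.map_cons, List.sum_cons]
      omega
    · have h : x 0 ^ (-c : ℤ) * x 0 ^ e = x 0 ^ (-n : ℤ) := by
        rw [← zpow_add]
        congr 1
        omega
      rw [List.map_cons, List.prod_cons, val_cons, mul_assoc (x _ ^ _) (val W), ← h2]
      simp only [← mul_assoc]
      rw [h, x_zero_zpow_mul]
    · simpa [hf] using h4
    · intro d y hy
      rw [List.cons_append, List.isChain_cons_cons]
      refine ⟨by simp only [Adj]; omega, ?_⟩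
      exact h5 f y hy

/-- The letters of an alternating word. -/
def letters (l : List (ℤ × ℤ)) : List (ℕ × ℤ) := l.flatMap fun p => [(0, p.1), (1, p.2)]

theorem val_letters (l : List (ℤ × ℤ)) :
    val (letters l) = (l.map fun p => x 0 ^ p.1 * x 1 ^ p.2).prod := by
  induction l with
  | nil => rfl
  | cons p l ih =>
    rw [List.map_cons, List.prod_cons, ← ih, mul_assoc]
    exact (val_cons _ _).trans (congrArg _ (val_cons _ _))

theorem exponent_letters (l : List (ℤ × ℤ)) : exponent 0 (letters l) = (l.map Prod.fst).sum := by
  induction l with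
  | nil => rfl
  | cons p l ih =>
    rw [List.map_cons, List.sum_cons, ← ih]
    simp [letters, exponent]

theorem alternating_prod_ne_one {l : List (ℤ × ℤ)} (hne : l ≠ [])
    (hl : ∀ p ∈ l, (p.1 = 1 ∨ p.1 = -1) ∧ (p.2 = 1 ∨ p.2 = -1)) :
    (l.map fun p => x 0 ^ p.1 * x 1 ^ p.2).prod ≠ 1 := by
  intro h
  have hsum : (l.map Prod.fst).sum = 0 := by
    rw [← exponent_letters]
    refine exponent_eq_zero (fun _ _ => Nat.zero_le _) ?_ ((val_letters l).trans h)
    intro q hq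
    obtain ⟨p, hp, hq⟩ := List.mem_flatMap.1 hq
    simp only [List.mem_cons, List.not_mem_nil, or_false] at hq
    rcases hq with rfl | rfl
    exacts [(hl p hp).1, (hl p hp).2]
  obtain ⟨W, c', h1, h2, h3, h4, h5⟩ := exists_walk l hl l.length le_rfl
  obtain rfl : c' = l.length := by omega
  rw [h, mul_one, right_eq_mul] at h2
  rcases W with _ | ⟨⟨n, f⟩, W⟩
  · exact hne (List.length_eq_zero_iff.1 h3.symm)
  refine val_ne_one (List.cons_ne_nil _ _) h4 ?_ h2
  have hadj : Adj (l.length + 1, 0) (n, f) :=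
    (List.isChain_cons_cons.1 (h5 0 (l.length, 0) (Or.inr rfl))).1
  exact (List.isChain_cons_cons.1 (h5 0 (n, f) hadj)).2

end ThompsonWalk

/-- With `a = x₀`, `b = x₁` in Thompson's group `F`, no alternating word
`a^{ε₁} b^{δ₁} ⋯ a^{ε_k} b^{δ_k}` with `k ≥ 1` represents the identity. -/
theorem thompson_no_alternating_relation_x0_x1
    (a b : ThompsonF) (ha : a = x 0) (hb : b = x 1)
    (k : ℕ) (hk : 1 ≤ k) (ε δ : Fin k → ℤ)
    (hε : ∀ l, ε l = 1 ∨ ε l = -1) (hδ : ∀ l, δ l = 1 ∨ δ l = -1) :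
    (List.ofFn (fun l : Fin k => a ^ (ε l) * b ^ (δ l))).prod ≠ 1 := by
  subst ha hb
  have h := ThompsonWalk.alternating_prod_ne_one (l := List.ofFn fun i => (ε i, δ i))
    (by rw [Ne, List.ofFn_eq_nil_iff]; omega)
    (by
      intro p hp
      obtain ⟨i, rfl⟩ := (List.mem_ofFn' _ _).1 hp
      exact ⟨hε i, hδ i⟩)
  rwa [List.map_ofFn] at h
end
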